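/- Let k ≥ 1, let u ∈ F_n^k be a unitary, let λ_u : A → A be a unital *-homomorphism with λ_u(Sᵢ) = uSᵢ for all i, and assume A is generated by S₁,…,Sₙ. For i, j ∈ {1,…,n} define a_{ij} : F_n^{k-1} → F_n^{k-1} by a_{ij}(x) = Sᵢ* u* x u Sⱼ, and define the decreasing sequence of subspaces Ξ₀ = F_n^{k-1}, Ξ_r = span{ a_{ij}(x) : x ∈ Ξ_{r-1}, 1 ≤ i, j ≤ n } for r ≥ 1. Then the following are equivalent: (1) there exist h ≥ 1, a unitary w ∈ F_n^h, and a unital *-homomorphism λ_w : A → A with λ_w(Sᵢ) = wSᵢ for all i such that λ_u ∘ λ_w = id_A = λ_w ∘ λ_u (λ_u is invertible with localized inverse); (2) there exists m ≥ 1 such that for every sequence (i₁,j₁),…,(i_m,j_m) of pairs from {1,…,n} the composite a_{i₁j₁} ∘ a_{i₂j₂} ∘ ⋯ ∘ a_{i_mj_m} maps F_n^{k-1} into ℂ·1 (i.e. the ring A_u generated by the induced maps on F_n^{k-1}/ℂ1 is nilpotent); (3) ⋂_{r≥0} Ξ_r = ℂ·1. -/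

import Mathlib

noncomputable section CuntzSetup

/-- The word `S_μ = S_{μ₁} ⋯ S_{μ_k}` associated to a multi-index `μ ∈ {1,…,n}^k`. -/
def cuntzWord {A : Type*} [Monoid A] {n k : ℕ} (S : Fin n → A) (μ : Fin k → Fin n) : A :=
  (List.ofFn fun i => S (μ i)).prod

/-- The canonical shift `φ(x) = ∑ᵢ Sᵢ x Sᵢ*`. -/
def cuntzPhi {A : Type*} [Ring A] [StarRing A] {n : ℕ} (S : Fin n → A) (x : A) : A :=
  ∑ i, S i * x * star (S i)

/-- `u_k = u φ(u) φ²(u) ⋯ φ^{k-1}(u)`. -/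
def cuntzUk {A : Type*} [Ring A] [StarRing A] {n : ℕ} (S : Fin n → A) (u : A) (k : ℕ) : A :=
  ((List.range k).map fun j => (cuntzPhi S)^[j] u).prod

/-- `F_n^k`, the linear span of `{S_μ S_ν* : |μ| = |ν| = k}`. -/
def cuntzF {A : Type*} [Ring A] [StarRing A] [Algebra ℂ A] {n : ℕ} (S : Fin n → A) (k : ℕ) :
    Submodule ℂ A :=
  Submodule.span ℂ {x | ∃ μ ν : Fin k → Fin n, x = cuntzWord S μ * star (cuntzWord S ν)}

end CuntzSetup

noncomputable section Stmt13Setup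

/-- The map `a_{ij}(x) = Sᵢ* u* x u Sⱼ`. -/
def cuntzAij {A : Type*} [Ring A] [StarRing A] {n : ℕ} (S : Fin n → A) (u : A)
    (p : Fin n × Fin n) (x : A) : A :=
  star (S p.1) * star u * x * u * S p.2

/-- The decreasing sequence of subspaces `Ξ₀ = F_n^k`,
`Ξ_{r+1} = span { a_{ij}(x) : x ∈ Ξ_r }`. -/
def cuntzXi {A : Type*} [Ring A] [StarRing A] [Algebra ℂ A] {n : ℕ} (S : Fin n → A) (u : A)
    (k : ℕ) : ℕ → Submodule ℂ A
  | 0 => cuntzF S k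
  | r + 1 => Submodule.span ℂ
      {y | ∃ p : Fin n × Fin n, ∃ x ∈ cuntzXi S u k r, y = cuntzAij S u p x}

end Stmt13Setup

section CuntzAlgebra

/-- The Cuntz relations, with the orthogonality of the ranges made explicit. -/
structure IsCuntzFamily {A : Type*} [Ring A] [StarRing A] {n : ℕ} (S : Fin n → A) : Prop where
  star_mul : ∀ i j, star (S i) * S j = if i = j then 1 else 0
  sum_mul_star : ∑ i, S i * star (S i) = 1

theorem isCuntzFamily_of_isometries {A : Type*} [NormedRing A] [StarRing A] [CStarRing A]
    [CompleteSpace A] [NormedAlgebra ℂ A] [StarModule ℂ A] {n : ℕ} (S : Fin n → A)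
    (hiso : ∀ i, star (S i) * S i = 1) (hcuntz : ∑ i, S i * star (S i) = 1) :
    IsCuntzFamily S := by
  refine ⟨fun i j => ?_, hcuntz⟩
  let _ : CStarAlgebra A := {}
  let _ := CStarAlgebra.spectralOrder A
  have _ := CStarAlgebra.spectralOrderedRing A
  split_ifs with hij
  · rw [hij, hiso]
  have key : ∑ k ∈ Finset.univ.erase j, star (star (S k) * S j) * (star (S k) * S j) = 0 := by
    have h : ∑ k, star (star (S k) * S j) * (star (S k) * S j) = 1 := by
      calc ∑ k, star (star (S k) * S j) * (star (S k) * S j)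
          = star (S j) * (∑ k, S k * star (S k)) * S j := by
            simp [Finset.mul_sum, Finset.sum_mul, mul_assoc]
        _ = 1 := by rw [hcuntz, mul_one, hiso]
    rw [← Finset.add_sum_erase _ _ (Finset.mem_univ j), hiso j] at h
    simpa using h
  have h0 := (Finset.sum_eq_zero_iff_of_nonneg fun k _ =>
    star_mul_self_nonneg (star (S k) * S j)).1 key i (by simp [hij])
  exact CStarRing.star_mul_self_eq_zero_iff _ |>.1 h0

variable {A : Type*} [Ring A] [StarRing A] {n : ℕ} {S : Fin n → A}

theorem IsCuntzFamily.star_mul_mul_eq (hS : IsCuntzFamily S) (i : Fin n) (x : A) :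
    star (S i) * (S i * x) = x := by
  rw [← mul_assoc, hS.star_mul, if_pos rfl, one_mul]

theorem cuntzPhi_mul (hS : IsCuntzFamily S) (x y : A) :
    cuntzPhi S (x * y) = cuntzPhi S x * cuntzPhi S y := by
  simp only [cuntzPhi, Finset.sum_mul_sum]
  refine Finset.sum_congr rfl fun i _ => ?_
  rw [Finset.sum_eq_single i]
  · simp only [mul_assoc, hS.star_mul_mul_eq]
  · intro j _ hj
    have := hS.star_mul i j
    rw [if_neg hj.symm] at this
    calc S i * x * star (S i) * (S j * y * star (S j))
        = S i * x * (star (S i) * S j) * y * star (S j) := by simp only [mul_assoc]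
      _ = 0 := by simp [this]
  · simp

theorem cuntzPhi_one (hS : IsCuntzFamily S) : cuntzPhi S 1 = 1 := by
  simpa [cuntzPhi] using hS.sum_mul_star

theorem cuntzPhi_zero : cuntzPhi S 0 = 0 := by simp [cuntzPhi]

theorem star_cuntzPhi (x : A) : star (cuntzPhi S x) = cuntzPhi S (star x) := by
  simp [cuntzPhi, mul_assoc]

theorem mul_eq_cuntzPhi_mul (hS : IsCuntzFamily S) (i : Fin n) (a : A) :
    S i * a = cuntzPhi S a * S i := by
  simp only [cuntzPhi, Finset.sum_mul, mul_assoc, hS.star_mul]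
  simp

theorem star_mul_cuntzPhi (hS : IsCuntzFamily S) (i : Fin n) (a : A) :
    star (S i) * cuntzPhi S a = a * star (S i) := by
  have := congrArg star (mul_eq_cuntzPhi_mul hS i (star a))
  simpa [star_cuntzPhi] using this.symm

theorem iterate_cuntzPhi_mul (hS : IsCuntzFamily S) (k : ℕ) (x y : A) :
    (cuntzPhi S)^[k] (x * y) = (cuntzPhi S)^[k] x * (cuntzPhi S)^[k] y := by
  induction k generalizing x y with
  | zero => rfl
  | succ k ih => simp only [Function.iterate_succ_apply, cuntzPhi_mul hS, ih]

theorem iterate_cuntzPhi_one (hS : IsCuntzFamily S) (k : ℕ) : (cuntzPhi S)^[k] 1 = 1 :=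
  Function.iterate_fixed (cuntzPhi_one hS) k

theorem iterate_cuntzPhi_zero (k : ℕ) : (cuntzPhi S)^[k] 0 = 0 :=
  Function.iterate_fixed cuntzPhi_zero k

theorem star_iterate_cuntzPhi (k : ℕ) (x : A) :
    star ((cuntzPhi S)^[k] x) = (cuntzPhi S)^[k] (star x) := by
  induction k generalizing x with
  | zero => rfl
  | succ k ih => simp only [Function.iterate_succ_apply, ← star_cuntzPhi, ih]

theorem cuntzPhi_mem_unitary (hS : IsCuntzFamily S) {U : A} (hU : U ∈ unitary A) :
    cuntzPhi S U ∈ unitary A := by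
  rw [Unitary.mem_iff] at hU ⊢
  simp only [star_cuntzPhi, ← cuntzPhi_mul hS, hU.1, hU.2, cuntzPhi_one hS, and_self]

theorem pow_mul_eq_iterate_cuntzPhi_mul (hS : IsCuntzFamily S) (i : Fin n) (j : ℕ) (a : A) :
    S i ^ j * a = (cuntzPhi S)^[j] a * S i ^ j := by
  induction j generalizing a with
  | zero => simp
  | succ j ih =>
    rw [pow_succ, mul_assoc, mul_eq_cuntzPhi_mul hS, ← mul_assoc, ih, mul_assoc,
      Function.iterate_succ_apply]

theorem star_pow_mul_iterate_cuntzPhi (hS : IsCuntzFamily S) (i : Fin n) (j : ℕ) (a : A) :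
    star (S i) ^ j * (cuntzPhi S)^[j] a = a * star (S i) ^ j := by
  have := congrArg star (pow_mul_eq_iterate_cuntzPhi_mul hS i j (star a))
  simpa [star_iterate_cuntzPhi] using this.symm

theorem star_pow_mul_pow (hS : IsCuntzFamily S) (i : Fin n) (j : ℕ) :
    star (S i) ^ j * S i ^ j = 1 := by
  induction j with
  | zero => simp
  | succ j ih =>
    rw [pow_succ, pow_succ', mul_assoc, hS.star_mul_mul_eq, ih]

/-- There are isometries whose first `D` shifts have range orthogonal to their own. -/
theorem exists_isometry_orthogonal_shifts (hn : 2 ≤ n) (hS : IsCuntzFamily S) (D : ℕ) :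
    ∃ s : A, star s * s = 1 ∧ ∀ j, 1 ≤ j → j ≤ D → star s * (cuntzPhi S)^[j] s = 0 := by
  let i₀ : Fin n := ⟨0, by omega⟩
  let i₁ : Fin n := ⟨1, by omega⟩
  have h10 : star (S i₁) * S i₀ = 0 := by rw [hS.star_mul, if_neg (by simp [i₀, i₁])]
  refine ⟨S i₀ ^ D * S i₁, ?_, fun j hj hjD => ?_⟩
  · rw [star_mul, star_pow, mul_assoc, ← mul_assoc (star (S i₀) ^ D), star_pow_mul_pow hS,
      one_mul, hS.star_mul, if_pos rfl]
  · obtain ⟨e, rfl⟩ := Nat.exists_eq_add_of_le hjD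
    obtain ⟨j, rfl⟩ := Nat.exists_eq_add_of_le hj
    set j' := 1 + j with hj'
    calc star (S i₀ ^ (j' + e) * S i₁) * (cuntzPhi S)^[j'] (S i₀ ^ (j' + e) * S i₁)
        = star (S i₁) * (star (S i₀) ^ e * (star (S i₀) ^ j' *
            (cuntzPhi S)^[j'] (S i₀ ^ (j' + e) * S i₁))) := by
          rw [star_mul, star_pow, add_comm j' e, pow_add]; simp only [mul_assoc]
      _ = star (S i₁) * ((star (S i₀) ^ e * S i₀ ^ e) * S i₀ ^ j' * S i₁ *
            star (S i₀) ^ j') := by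
          rw [star_pow_mul_iterate_cuntzPhi hS, add_comm j' e, pow_add]; simp only [mul_assoc]
      _ = (star (S i₁) * S i₀) * (S i₀ ^ j * S i₁ * star (S i₀) ^ j') := by
          rw [star_pow_mul_pow hS, one_mul, hj', pow_add]; simp only [mul_assoc, pow_one]
      _ = 0 := by rw [h10, zero_mul]

theorem star_cuntzWord {k : ℕ} (μ : Fin k → Fin n) :
    star (cuntzWord S μ) = cuntzWord (fun i => star (S i)) (fun i => μ i.rev) := by
  have h : ∀ l : List A, star l.prod = (l.map star).reverse.prod := by
    intro l
    induction l with
    | nil => simp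
    | cons a l ih => simp [ih]
  rw [cuntzWord, h, cuntzWord, List.map_ofFn]
  congr 1
  refine List.ext_getElem (by simp) fun i _ _ => ?_
  simp only [List.getElem_reverse, List.getElem_ofFn, List.length_ofFn, Function.comp_apply]
  congr 3
  ext
  simp only [Fin.val_rev]
  omega

end CuntzAlgebra

noncomputable section CuntzGrading

variable {A : Type*} [Ring A] [Algebra ℂ A] {n : ℕ} {S : Fin n → A}

/-- The linear span of the isometries. -/
def cuntzV (S : Fin n → A) : Submodule ℂ A := Submodule.span ℂ (Set.range S)

theorem mem_cuntzV (i : Fin n) : S i ∈ cuntzV S := Submodule.subset_span ⟨i, rfl⟩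

theorem span_range_pow (T : Fin n → A) (k : ℕ) :
    Submodule.span ℂ (Set.range T) ^ k =
      Submodule.span ℂ {x | ∃ μ : Fin k → Fin n, x = cuntzWord T μ} := by
  rw [Submodule.span_pow]
  congr 1
  ext x
  rw [Set.mem_pow]
  constructor
  · rintro ⟨f, rfl⟩
    choose μ hμ using fun i => (f i).2
    exact ⟨μ, by simp [cuntzWord, hμ]⟩
  · rintro ⟨μ, rfl⟩
    exact ⟨fun i => ⟨T (μ i), μ i, rfl⟩, rfl⟩

variable [StarRing A]

/-- The linear span of the adjoints of the isometries. -/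
def cuntzVStar (S : Fin n → A) : Submodule ℂ A :=
  Submodule.span ℂ (Set.range fun i => star (S i))

/-- The span of the elements `S_μ S_ν*` with `|μ| = r` and `|ν| = c`. -/
def cuntzH (S : Fin n → A) (r c : ℕ) : Submodule ℂ A := cuntzV S ^ r * cuntzVStar S ^ c

theorem star_mem_cuntzVStar (i : Fin n) : star (S i) ∈ cuntzVStar S :=
  Submodule.subset_span ⟨i, rfl⟩

theorem cuntzF_eq_cuntzH (k : ℕ) : cuntzF S k = cuntzH S k k := by
  rw [cuntzH, cuntzV, cuntzVStar, span_range_pow, span_range_pow, Submodule.span_mul_span, cuntzF]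
  congr 1
  ext x
  simp only [Set.mem_ofPred_eq, Set.mem_mul]
  constructor
  · rintro ⟨μ, ν, rfl⟩
    exact ⟨_, ⟨μ, rfl⟩, _, ⟨_, rfl⟩, by rw [star_cuntzWord]⟩
  · rintro ⟨_, ⟨μ, rfl⟩, _, ⟨ν, rfl⟩, rfl⟩
    exact ⟨μ, fun i => ν i.rev, by simp [star_cuntzWord]⟩

theorem cuntzVStar_mul_cuntzV_le (hS : IsCuntzFamily S) :
    cuntzVStar S * cuntzV S ≤ 1 := by
  rw [cuntzV, cuntzVStar, Submodule.span_mul_span, Submodule.span_le]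
  rintro _ ⟨_, ⟨i, rfl⟩, _, ⟨j, rfl⟩, rfl⟩
  simp only [hS.star_mul]
  split_ifs
  · exact Submodule.one_le.1 le_rfl
  · exact zero_mem _

theorem one_le_cuntzV_mul_cuntzVStar (hS : IsCuntzFamily S) :
    1 ≤ cuntzV S * cuntzVStar S := by
  rw [Submodule.one_le, ← hS.sum_mul_star]
  exact sum_mem fun i _ => Submodule.mul_mem_mul (mem_cuntzV i) (star_mem_cuntzVStar i)

theorem cuntzVStar_pow_mul_cuntzV_pow_le (hS : IsCuntzFamily S) (k : ℕ) :
    cuntzVStar S ^ k * cuntzV S ^ k ≤ 1 := by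
  induction k with
  | zero => simp
  | succ k ih =>
    calc cuntzVStar S ^ (k + 1) * cuntzV S ^ (k + 1)
        = cuntzVStar S ^ k * (cuntzVStar S * cuntzV S) * cuntzV S ^ k := by
          rw [pow_succ, pow_succ']; simp only [mul_assoc]
      _ ≤ cuntzVStar S ^ k * 1 * cuntzV S ^ k := by gcongr; exact cuntzVStar_mul_cuntzV_le hS
      _ ≤ 1 := by rwa [mul_one]

theorem cuntzH_mul_cuntzH_le (hS : IsCuntzFamily S) (r c t : ℕ) :
    cuntzH S r c * cuntzH S c t ≤ cuntzH S r t := by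
  calc cuntzH S r c * cuntzH S c t
      = cuntzV S ^ r * (cuntzVStar S ^ c * cuntzV S ^ c) * cuntzVStar S ^ t := by
        simp only [cuntzH, mul_assoc]
    _ ≤ cuntzV S ^ r * 1 * cuntzVStar S ^ t := by
        gcongr; exact cuntzVStar_pow_mul_cuntzV_pow_le hS c
    _ = cuntzH S r t := by rw [mul_one, cuntzH]

theorem cuntzH_le_add (hS : IsCuntzFamily S) (r c t : ℕ) :
    cuntzH S r c ≤ cuntzH S (r + t) (c + t) := by
  induction t with
  | zero => exact le_rfl
  | succ t ih =>
    refine ih.trans ?_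
    calc cuntzH S (r + t) (c + t) = cuntzV S ^ (r + t) * 1 * cuntzVStar S ^ (c + t) := by
          rw [mul_one, cuntzH]
      _ ≤ cuntzV S ^ (r + t) * (cuntzV S * cuntzVStar S) * cuntzVStar S ^ (c + t) := by
          gcongr; exact one_le_cuntzV_mul_cuntzVStar hS
      _ = cuntzH S (r + (t + 1)) (c + (t + 1)) := by
          rw [cuntzH, ← add_assoc, ← add_assoc, pow_succ, pow_succ' _ (c + t)]
          simp only [mul_assoc]

theorem cuntzV_mul_cuntzH (r c : ℕ) : cuntzV S * cuntzH S r c = cuntzH S (r + 1) c := by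
  rw [cuntzH, cuntzH, pow_succ', mul_assoc]

theorem cuntzH_mul_cuntzVStar (r c : ℕ) : cuntzH S r c * cuntzVStar S = cuntzH S r (c + 1) := by
  rw [cuntzH, cuntzH, pow_succ, mul_assoc]

theorem cuntzVStar_mul_cuntzH_le (hS : IsCuntzFamily S) (r c : ℕ) :
    cuntzVStar S * cuntzH S (r + 1) c ≤ cuntzH S r c := by
  rw [← cuntzV_mul_cuntzH, ← mul_assoc]
  exact (mul_le_mul_left (cuntzVStar_mul_cuntzV_le hS) _).trans (one_mul _).le

theorem cuntzH_mul_cuntzV_le (hS : IsCuntzFamily S) (r c : ℕ) :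
    cuntzH S r (c + 1) * cuntzV S ≤ cuntzH S r c := by
  rw [← cuntzH_mul_cuntzVStar, mul_assoc]
  exact (mul_le_mul_right (cuntzVStar_mul_cuntzV_le hS) _).trans (mul_one _).le

theorem star_mul_mul_mem_cuntzH (hS : IsCuntzFamily S) {r c : ℕ} {x : A}
    (hx : x ∈ cuntzH S (r + 1) (c + 1)) (i j : Fin n) :
    star (S i) * x * S j ∈ cuntzH S r c :=
  cuntzH_mul_cuntzV_le hS _ _ <| Submodule.mul_mem_mul (cuntzVStar_mul_cuntzH_le hS _ _ <|
    Submodule.mul_mem_mul (star_mem_cuntzVStar i) hx) (mem_cuntzV j)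

theorem mul_mul_star_mem_cuntzH {r c : ℕ} {x : A}
    (hx : x ∈ cuntzH S r c) (i j : Fin n) :
    S i * x * star (S j) ∈ cuntzH S (r + 1) (c + 1) := by
  rw [← cuntzH_mul_cuntzVStar, ← cuntzV_mul_cuntzH]
  exact Submodule.mul_mem_mul (Submodule.mul_mem_mul (mem_cuntzV i) hx) (star_mem_cuntzVStar j)

theorem star_mem_cuntzF {k : ℕ} {x : A} [StarModule ℂ A] (hx : x ∈ cuntzF S k) :
    star x ∈ cuntzF S k := by
  induction hx using Submodule.span_induction with
  | mem x hx =>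
    obtain ⟨μ, ν, rfl⟩ := hx
    exact Submodule.subset_span ⟨ν, μ, by simp⟩
  | zero => simp
  | add x y _ _ hx hy => simpa using add_mem hx hy
  | smul a x _ hx => simpa using Submodule.smul_mem _ (star a) hx

/-- Elements of `cuntzH S r c` intertwine the iterates of the canonical shift. -/
theorem mul_iterate_cuntzPhi (hS : IsCuntzFamily S) {r c : ℕ} {x : A} (hx : x ∈ cuntzH S r c)
    (a : A) : x * (cuntzPhi S)^[c] a = (cuntzPhi S)^[r] a * x := by
  have hV : ∀ y ∈ cuntzV S, ∀ a, y * a = cuntzPhi S a * y := by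
    intro y hy a
    induction hy using Submodule.span_induction with
    | mem x hx => obtain ⟨i, rfl⟩ := hx; exact mul_eq_cuntzPhi_mul hS i a
    | zero => simp
    | add x y _ _ hx hy => rw [add_mul, mul_add, hx, hy]
    | smul t x _ hx => rw [smul_mul_assoc, mul_smul_comm, hx]
  have hV' : ∀ y ∈ cuntzVStar S, ∀ a, y * cuntzPhi S a = a * y := by
    intro y hy a
    induction hy using Submodule.span_induction with
    | mem x hx => obtain ⟨i, rfl⟩ := hx; exact star_mul_cuntzPhi hS i a
    | zero => simp
    | add x y _ _ hx hy => rw [add_mul, mul_add, hx, hy]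
    | smul t x _ hx => rw [smul_mul_assoc, mul_smul_comm, hx]
  have hr : ∀ r, ∀ y ∈ cuntzV S ^ r, ∀ a, y * a = (cuntzPhi S)^[r] a * y := by
    intro r
    induction r with
    | zero =>
      intro y hy a
      obtain ⟨t, rfl⟩ := Submodule.mem_one.1 (by simpa using hy)
      exact Algebra.commutes t a
    | succ r ih =>
      intro y hy a
      rw [pow_succ] at hy
      refine Submodule.mul_induction_on hy (fun p hp q hq => ?_) fun p q hp hq => ?_
      · rw [mul_assoc, hV q hq, ← mul_assoc, ih p hp, mul_assoc, Function.iterate_succ_apply]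
      · rw [add_mul, mul_add, hp, hq]
  have hc : ∀ c, ∀ y ∈ cuntzVStar S ^ c, ∀ a, y * (cuntzPhi S)^[c] a = a * y := by
    intro r
    induction r with
    | zero =>
      intro y hy a
      obtain ⟨t, rfl⟩ := Submodule.mem_one.1 (by simpa using hy)
      exact Algebra.commutes t a
    | succ r ih =>
      intro y hy a
      rw [pow_succ'] at hy
      refine Submodule.mul_induction_on hy (fun p hp q hq => ?_) fun p q hp hq => ?_
      · rw [mul_assoc, Function.iterate_succ_apply, ih q hq, ← mul_assoc, hV' p hp, mul_assoc]
      · rw [add_mul, mul_add, hp, hq]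
  refine Submodule.mul_induction_on hx (fun p hp q hq => ?_) fun p q hp hq => ?_
  · rw [mul_assoc, hc c q hq, ← mul_assoc, hr r p hp, mul_assoc]
  · rw [add_mul, mul_add, hp, hq]

end CuntzGrading

section CuntzFiltration

variable {A : Type*} [Ring A] [StarRing A] [Algebra ℂ A] {n : ℕ} {S : Fin n → A}

theorem one_le_cuntzH (hS : IsCuntzFamily S) (k : ℕ) : 1 ≤ cuntzH S k k := by
  simpa [cuntzH] using cuntzH_le_add hS 0 0 k

theorem cuntzVStar_pow_mul_le (hS : IsCuntzFamily S) (r c : ℕ) :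
    cuntzVStar S ^ c * cuntzV S ^ r ≤ cuntzV S ^ r * cuntzVStar S ^ c := by
  have h1 : cuntzVStar S * cuntzV S ≤ cuntzV S * cuntzVStar S :=
    (cuntzVStar_mul_cuntzV_le hS).trans (one_le_cuntzV_mul_cuntzVStar hS)
  have h2 : ∀ r, cuntzVStar S * cuntzV S ^ r ≤ cuntzV S ^ r * cuntzVStar S := by
    intro r
    induction r with
    | zero => simp
    | succ r ih =>
      rw [pow_succ, ← mul_assoc]
      refine (mul_le_mul_left ih _).trans ?_
      rw [mul_assoc, mul_assoc]
      exact mul_le_mul_right h1 _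
  induction c with
  | zero => simp
  | succ c ih =>
    rw [pow_succ, mul_assoc]
    refine (mul_le_mul_right (h2 r) _).trans ?_
    rw [← mul_assoc, ← mul_assoc]
    exact mul_le_mul_left ih _

theorem cuntzH_mul_cuntzH_le_add (hS : IsCuntzFamily S) (r c r' c' : ℕ) :
    cuntzH S r c * cuntzH S r' c' ≤ cuntzH S (r + r') (c + c') := by
  calc cuntzH S r c * cuntzH S r' c'
      = cuntzV S ^ r * (cuntzVStar S ^ c * cuntzV S ^ r') * cuntzVStar S ^ c' := by
        simp only [cuntzH, mul_assoc]
    _ ≤ cuntzV S ^ r * (cuntzV S ^ r' * cuntzVStar S ^ c) * cuntzVStar S ^ c' := by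
        gcongr ?_ * _
        exact mul_le_mul_right (cuntzVStar_pow_mul_le hS r' c) _
    _ = cuntzH S (r + r') (c + c') := by
        simp only [cuntzH, pow_add, mul_assoc]

/-- The sum of the spaces `cuntzH S r N` for `r ≤ D`. -/
def cuntzQ (S : Fin n → A) (D N : ℕ) : Submodule ℂ A :=
  ⨆ r ∈ Finset.range (D + 1), cuntzH S r N

theorem mem_cuntzQ {D N : ℕ} {x : A} : x ∈ cuntzQ S D N ↔
    ∃ f : (r : ℕ) → cuntzH S r N, ∑ r ∈ Finset.range (D + 1), (f r : A) = x :=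
  Submodule.mem_iSup_finset_iff_exists_sum _ _

theorem cuntzH_le_cuntzQ {r D : ℕ} (h : r ≤ D) (N : ℕ) : cuntzH S r N ≤ cuntzQ S D N :=
  le_iSup₂_of_le (f := fun r _ => cuntzH S r N) r (Finset.mem_range.2 (by omega)) le_rfl

theorem mul_mem_cuntzQ (hS : IsCuntzFamily S) {D N D' N' : ℕ} {x y : A} (hx : x ∈ cuntzQ S D N)
    (hy : y ∈ cuntzQ S D' N') : x * y ∈ cuntzQ S (D + D') (N + N') := by
  obtain ⟨f, rfl⟩ := mem_cuntzQ.1 hx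
  obtain ⟨g, rfl⟩ := mem_cuntzQ.1 hy
  rw [Finset.sum_mul_sum]
  refine sum_mem fun r hr => sum_mem fun r' hr' => ?_
  rw [Finset.mem_range] at hr hr'
  exact cuntzH_le_cuntzQ (by omega) _ <| cuntzH_mul_cuntzH_le_add hS r N r' N' <|
    Submodule.mul_mem_mul (f r).2 (g r').2

theorem pow_mem_cuntzQ (hS : IsCuntzFamily S) {D N : ℕ} {x : A} (hx : x ∈ cuntzQ S D N) (m : ℕ) :
    x ^ m ∈ cuntzQ S (m * D) (m * N) := by
  induction m with
  | zero => simpa using cuntzH_le_cuntzQ le_rfl _ (one_le_cuntzH hS 0 (Submodule.one_le.1 le_rfl))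
  | succ m ih => rw [pow_succ, add_mul, add_mul, one_mul, one_mul]; exact mul_mem_cuntzQ hS ih hx

theorem cuntzQ_le_add (hS : IsCuntzFamily S) {D N : ℕ} (D' N' : ℕ) :
    cuntzQ S D N ≤ cuntzQ S (D + D' + N') (N + N') := by
  refine iSup₂_le fun r hr => ?_
  rw [Finset.mem_range] at hr
  exact (cuntzH_le_add hS r N N').trans (cuntzH_le_cuntzQ (by omega) _)

theorem exists_mem_cuntzQ [StarModule ℂ A] (hS : IsCuntzFamily S) {x : A}
    (hx : x ∈ StarAlgebra.adjoin ℂ (Set.range S)) : ∃ D N, x ∈ cuntzQ S D N := by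
  change x ∈ Algebra.adjoin ℂ (Set.range S ∪ star (Set.range S)) at hx
  induction hx using Algebra.adjoin_induction with
  | mem x hx =>
    rcases hx with ⟨i, rfl⟩ | ⟨i, hi⟩
    · exact ⟨1, 0, cuntzH_le_cuntzQ le_rfl _ (by simpa [cuntzH] using mem_cuntzV i)⟩
    · refine ⟨0, 1, cuntzH_le_cuntzQ le_rfl _ ?_⟩
      rw [← star_star x, ← hi]
      simpa [cuntzH] using star_mem_cuntzVStar i
  | algebraMap r =>
    exact ⟨0, 0, cuntzH_le_cuntzQ le_rfl _ <| one_le_cuntzH hS 0 (Submodule.algebraMap_mem r)⟩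
  | add x y _ _ ihx ihy =>
    obtain ⟨D, N, h⟩ := ihx
    obtain ⟨D', N', h'⟩ := ihy
    refine ⟨D + D' + (N + N'), N + N', add_mem ?_ ?_⟩
    · have := cuntzQ_le_add hS (D' + N) N' h
      rwa [show D + (D' + N) + N' = D + D' + (N + N') by omega] at this
    · have := cuntzQ_le_add hS (D + N') N h'
      rwa [show D' + (D + N') + N = D + D' + (N + N') by omega, add_comm N'] at this
  | mul x y _ _ ihx ihy =>
    obtain ⟨D, N, h⟩ := ihx
    obtain ⟨D', N', h'⟩ := ihy
    exact ⟨_, _, mul_mem_cuntzQ hS h h'⟩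

variable {L : A →⋆ₐ[ℂ] A} {u : A}

/-- An endomorphism `S_i ↦ u S_i` with `u ∈ F_n^{K+1}` raises the level by at most `K`. -/
theorem map_mem_cuntzH [StarModule ℂ A] (hS : IsCuntzFamily S) (hL : ∀ i, L (S i) = u * S i) {K : ℕ}
    (hu : u ∈ cuntzF S (K + 1)) {r c : ℕ} {x : A} (hx : x ∈ cuntzH S r c) :
    L x ∈ cuntzH S (r + K) (c + K) := by
  have hus : star u ∈ cuntzH S (K + 1) (K + 1) := by
    rw [← cuntzF_eq_cuntzH]; exact star_mem_cuntzF hu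
  rw [cuntzF_eq_cuntzH] at hu
  have hV : (cuntzV S).map L.toAlgHom.toLinearMap ≤ cuntzH S (K + 1) K := by
    rw [cuntzV, Submodule.map_span_le]
    rintro _ ⟨i, rfl⟩
    change L (S i) ∈ _
    rw [hL]
    exact cuntzH_mul_cuntzV_le hS _ _ (Submodule.mul_mem_mul hu (mem_cuntzV i))
  have hV' : (cuntzVStar S).map L.toAlgHom.toLinearMap ≤ cuntzH S K (K + 1) := by
    rw [cuntzVStar, Submodule.map_span_le]
    rintro _ ⟨i, rfl⟩
    change L (star (S i)) ∈ _
    rw [map_star, hL, star_mul]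
    exact cuntzVStar_mul_cuntzH_le hS _ _ (Submodule.mul_mem_mul (star_mem_cuntzVStar i) hus)
  have hr : (cuntzV S ^ r).map L.toAlgHom.toLinearMap ≤ cuntzH S (r + K) K := by
    rw [Submodule.map_pow]
    refine (pow_le_pow_left' hV r).trans ?_
    clear hx
    induction r with
    | zero => simpa using one_le_cuntzH hS K
    | succ r ih =>
      rw [pow_succ]
      refine (mul_le_mul' (ih.trans (cuntzH_le_add hS _ _ 1)) le_rfl).trans ?_
      rw [add_right_comm]
      exact cuntzH_mul_cuntzH_le hS _ _ _
  have hc : (cuntzVStar S ^ c).map L.toAlgHom.toLinearMap ≤ cuntzH S K (c + K) := by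
    rw [Submodule.map_pow]
    refine (pow_le_pow_left' hV' c).trans ?_
    clear hx
    induction c with
    | zero => simpa using one_le_cuntzH hS K
    | succ c ih =>
      rw [pow_succ']
      refine (mul_le_mul' le_rfl (ih.trans (cuntzH_le_add hS _ _ 1))).trans ?_
      rw [add_right_comm]
      exact cuntzH_mul_cuntzH_le hS _ _ _
  have h := Submodule.mem_map_of_mem (f := L.toAlgHom.toLinearMap) hx
  rw [cuntzH, Submodule.map_mul] at h
  exact cuntzH_mul_cuntzH_le hS _ _ _ (mul_le_mul' hr hc h)

/-- On words of length `r` the endomorphism `S_i ↦ u S_i` is multiplication by a unitary. -/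
theorem exists_unitary_map_eq_mul (hS : IsCuntzFamily S) (hL : ∀ i, L (S i) = u * S i)
    (hu : u ∈ unitary A) (r : ℕ) : ∃ U ∈ unitary A,
      (∀ x ∈ cuntzV S ^ r, L x = U * x) ∧ ∀ x ∈ cuntzVStar S ^ r, L x = x * star U := by
  induction r with
  | zero =>
    refine ⟨1, one_mem _, fun x hx => ?_, fun x hx => ?_⟩ <;>
    · obtain ⟨t, rfl⟩ := Submodule.mem_one.1 (by simpa using hx)
      simpa using AlgHomClass.commutes L t
  | succ r ih =>
    obtain ⟨U, hU, h1, h2⟩ := ih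
    refine ⟨u * cuntzPhi S U, mul_mem hu (cuntzPhi_mem_unitary hS hU), fun x hx => ?_,
      fun x hx => ?_⟩
    · rw [pow_succ'] at hx
      refine Submodule.mul_induction_on hx (fun p hp q hq => ?_) fun p q hp hq => ?_
      · induction hp using Submodule.span_induction with
        | mem x hx =>
          obtain ⟨i, rfl⟩ := hx
          rw [map_mul, hL, h1 q hq, mul_assoc, mul_assoc, ← mul_assoc _ U,
            mul_eq_cuntzPhi_mul hS, mul_assoc]
        | zero => simp
        | add x y _ _ hx hy => rw [add_mul, map_add, hx, hy, mul_add]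
        | smul t x _ hx => rw [smul_mul_assoc, map_smul, hx, mul_smul_comm]
      · rw [map_add, hp, hq, mul_add]
    · rw [pow_succ] at hx
      refine Submodule.mul_induction_on hx (fun p hp q hq => ?_) fun p q hp hq => ?_
      · induction hq using Submodule.span_induction with
        | mem x hx =>
          obtain ⟨i, rfl⟩ := hx
          rw [map_mul, map_star, hL, h2 p hp, star_mul, star_mul, star_cuntzPhi, mul_assoc,
            ← mul_assoc (star U), ← star_mul_cuntzPhi hS]
          simp only [mul_assoc]
        | zero => simp
        | add x y _ _ hx hy => rw [mul_add, map_add, hx, hy, add_mul]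
        | smul t x _ hx => rw [mul_smul_comm, map_smul, hx, smul_mul_assoc]
      · rw [map_add, hp, hq, add_mul]

end CuntzFiltration

section CuntzNorm

theorem le_of_forall_pow_two_pow_le {a b D : ℝ} (hb : 0 ≤ b)
    (h : ∀ j : ℕ, a ^ 2 ^ j ≤ ((2 ^ j : ℕ) * D + 1) * b ^ 2 ^ j) : a ≤ b := by
  by_contra! hab
  rcases hb.eq_or_lt with rfl | hb
  · have := h 0
    simp at this
    linarith
  have ht : 1 < a / b := (one_lt_div hb).2 hab
  have hlim : Filter.Tendsto (fun m : ℕ => ((m : ℝ) * D + 1) / (a / b) ^ m) Filter.atTop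
      (nhds 0) := by
    have h1 := (tendsto_pow_const_div_const_pow_of_one_lt 1 ht).mul_const D
    have h0 := tendsto_pow_const_div_const_pow_of_one_lt 0 ht
    have := h1.add h0
    simp only [zero_mul, add_zero, pow_one, pow_zero] at this
    refine this.congr fun m => ?_
    ring
  have hsub := hlim.comp (tendsto_pow_atTop_atTop_of_one_lt (one_lt_two : 1 < 2))
  have := ge_of_tendsto hsub (b := 1) <| Filter.Eventually.of_forall fun j => by
    have hj := h j
    rw [Function.comp_apply, le_div_iff₀ (by positivity), one_mul, div_pow,
      div_le_iff₀ (by positivity)]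
    exact hj
  linarith

theorem norm_le_one_of_star_mul_self {A : Type*} [NormedRing A] [StarRing A] [CStarRing A]
    {s : A} (hs : star s * s = 1) : ‖s‖ ≤ 1 := by
  rcases subsingleton_or_nontrivial A with _ | _
  · simp [Subsingleton.elim s 0]
  · have h := CStarRing.norm_star_mul_self (x := s)
    rw [hs, CStarRing.norm_one] at h
    nlinarith [norm_nonneg s]

variable {A : Type*} [NormedRing A] [StarRing A] [CStarRing A] [NormedAlgebra ℂ A]
  {n : ℕ} {S : Fin n → A} {L : A →⋆ₐ[ℂ] A} {u : A}

theorem norm_map_eq_of_mem_cuntzH (hS : IsCuntzFamily S) (hL : ∀ i, L (S i) = u * S i)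
    (hu : u ∈ unitary A) {r c : ℕ} {x : A} (hx : x ∈ cuntzH S r c) : ‖L x‖ = ‖x‖ := by
  obtain ⟨U, hU, hU', -⟩ := exists_unitary_map_eq_mul hS hL hu r
  obtain ⟨W, hW, -, hW'⟩ := exists_unitary_map_eq_mul hS hL hu c
  have h : L x = U * x * star W := by
    refine Submodule.mul_induction_on hx (fun p hp q hq => ?_) fun p q hp hq => ?_
    · rw [map_mul, hU' p hp, hW' q hq]; simp only [mul_assoc]
    · rw [map_add, hp, hq, mul_add, add_mul]
  rw [h, CStarRing.norm_mul_mem_unitary _ (Unitary.star_mem hW), CStarRing.norm_mem_unitary_mul _ hU]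

theorem norm_le_of_mem_cuntzQ [StarModule ℂ A] (hn : 2 ≤ n) (hS : IsCuntzFamily S)
    (hL : ∀ i, L (S i) = u * S i) (hu : u ∈ unitary A) {K : ℕ} (huF : u ∈ cuntzF S (K + 1))
    {D N : ℕ} {x : A} (hx : x ∈ cuntzQ S D N) : ‖x‖ ≤ (D + 1) * ‖L x‖ := by
  obtain ⟨f, rfl⟩ := mem_cuntzQ.1 hx
  obtain ⟨s, hs, hsD⟩ := exists_isometry_orthogonal_shifts hn hS D
  have hiso : ∀ k, star ((cuntzPhi S)^[k] s) * (cuntzPhi S)^[k] s = 1 := fun k => by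
    rw [star_iterate_cuntzPhi, ← iterate_cuntzPhi_mul hS, hs, iterate_cuntzPhi_one hS]
  have horth : ∀ k j, 1 ≤ j → j ≤ D →
      star ((cuntzPhi S)^[k] s) * (cuntzPhi S)^[k + j] s = 0 := fun k j h1 h2 => by
    rw [star_iterate_cuntzPhi, Function.iterate_add_apply, ← iterate_cuntzPhi_mul hS,
      hsD j h1 h2, iterate_cuntzPhi_zero]
  have horth' : ∀ k j, 1 ≤ j → j ≤ D →
      star ((cuntzPhi S)^[k + j] s) * (cuntzPhi S)^[k] s = 0 := fun k j h1 h2 => by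
    simpa using congrArg star (horth k j h1 h2)
  have hcomp : ∀ r ∈ Finset.range (D + 1), ‖(f r : A)‖ ≤
      ‖L (∑ r ∈ Finset.range (D + 1), (f r : A))‖ := by
    intro r hr
    have hL' : star ((cuntzPhi S)^[r + K] s) * L (∑ r ∈ Finset.range (D + 1), (f r : A)) *
        (cuntzPhi S)^[N + K] s = L (f r) := by
      rw [map_sum, Finset.mul_sum, Finset.sum_mul, Finset.sum_eq_single r]
      · rw [mul_assoc, mul_iterate_cuntzPhi hS (map_mem_cuntzH hS hL huF (f r).2), ← mul_assoc,
          hiso, one_mul]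
      · intro e he her
        rw [Finset.mem_range] at he hr
        rw [mul_assoc, mul_iterate_cuntzPhi hS (map_mem_cuntzH hS hL huF (f e).2), ← mul_assoc]
        rcases lt_or_gt_of_ne her with h | h
        · obtain ⟨d, rfl⟩ := Nat.exists_eq_add_of_lt h
          rw [show e + d + 1 + K = e + K + (d + 1) by omega, horth' _ _ (by omega) (by omega),
            zero_mul]
        · obtain ⟨d, rfl⟩ := Nat.exists_eq_add_of_lt h
          rw [show r + d + 1 + K = r + K + (d + 1) by omega, horth _ _ (by omega) (by omega),
            zero_mul]
      · exact fun h => absurd hr h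
    rw [← norm_map_eq_of_mem_cuntzH hS hL hu (f r).2, ← hL']
    refine (norm_mul_le _ _).trans ?_
    refine (mul_le_mul (norm_mul_le _ _) (norm_le_one_of_star_mul_self (hiso _))
      (norm_nonneg _) (by positivity)).trans ?_
    rw [mul_one, norm_star]
    exact mul_le_of_le_one_left (norm_nonneg _) (norm_le_one_of_star_mul_self (hiso _))
  calc ‖∑ r ∈ Finset.range (D + 1), (f r : A)‖
      ≤ ∑ r ∈ Finset.range (D + 1), ‖(f r : A)‖ := norm_sum_le _ _
    _ ≤ ∑ r ∈ Finset.range (D + 1), ‖L (∑ r ∈ Finset.range (D + 1), (f r : A))‖ :=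
        Finset.sum_le_sum hcomp
    _ = (D + 1) * ‖L (∑ r ∈ Finset.range (D + 1), (f r : A))‖ := by
        rw [Finset.sum_const, Finset.card_range, nsmul_eq_mul]; push_cast; rfl

/-- An endomorphism `S_i ↦ u S_i` with `u` a unitary in some `F_n^k` is isometric: a bound that
grows polynomially in the degree becomes contractive after passing to high powers. -/
theorem isometry_of_mem_cuntzF [CompleteSpace A] [StarModule ℂ A] (hn : 2 ≤ n) (hS : IsCuntzFamily S)
    (hgen : (StarAlgebra.adjoin ℂ (Set.range S)).topologicalClosure = ⊤)
    (hL : ∀ i, L (S i) = u * S i) (hu : u ∈ unitary A) {K : ℕ} (huF : u ∈ cuntzF S (K + 1)) :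
    Isometry L := by
  let _ : CStarAlgebra A := {}
  have hle : ∀ a, ‖L a‖ ≤ ‖a‖ := NonUnitalStarAlgHom.norm_apply_le L
  have hcont : Continuous L := AddMonoidHomClass.continuous_of_bound L 1 (by simpa using hle)
  have hadj : ∀ a ∈ StarAlgebra.adjoin ℂ (Set.range S), ‖a‖ ≤ ‖L a‖ := by
    intro a ha
    have hq : star a * a ∈ StarAlgebra.adjoin ℂ (Set.range S) := mul_mem (star_mem ha) ha
    obtain ⟨D, N, hDN⟩ := exists_mem_cuntzQ hS hq
    have hsa : IsSelfAdjoint (star a * a) := .star_mul_self a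
    have hpow : ∀ x : A, IsSelfAdjoint x → ∀ j, ‖x ^ 2 ^ j‖ = ‖x‖ ^ 2 ^ j := fun x hx j => by
      simpa using congrArg NNReal.toReal (hx.nnnorm_pow_two_pow j)
    have h : ‖star a * a‖ ≤ ‖L (star a * a)‖ := by
      refine le_of_forall_pow_two_pow_le (D := D) (norm_nonneg _) fun j => ?_
      rw [← hpow _ hsa, ← hpow _ (hsa.map L), ← map_pow]
      have := norm_le_of_mem_cuntzQ hn hS hL hu huF (pow_mem_cuntzQ hS hDN (2 ^ j))
      simpa using this
    rw [map_mul, map_star, CStarRing.norm_star_mul_self, CStarRing.norm_star_mul_self] at h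
    exact nonneg_le_nonneg_of_sq_le_sq (norm_nonneg _) h
  refine AddMonoidHomClass.isometry_of_norm L fun a => (hle a).antisymm ?_
  have hclosed : IsClosed {a : A | ‖a‖ ≤ ‖L a‖} := isClosed_le continuous_norm hcont.norm
  have ha : a ∈ (StarAlgebra.adjoin ℂ (Set.range S)).topologicalClosure := by simp [hgen]
  exact closure_minimal hadj hclosed ha

end CuntzNorm

section CuntzNilpotent

variable {A : Type*} [Ring A] [StarRing A] {n : ℕ} {S : Fin n → A} {u : A}

theorem cuntzAij_one (hS : IsCuntzFamily S) (hu : u ∈ unitary A) (i : Fin n) :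
    cuntzAij S u (i, i) 1 = 1 := by
  rw [cuntzAij, mul_one, mul_assoc (star (S i)), Unitary.star_mul_self_of_mem hu, mul_one,
    hS.star_mul, if_pos rfl]

theorem sum_mul_cuntzAij_mul (hS : IsCuntzFamily S) (hu : u ∈ unitary A) (x : A) :
    ∑ i, ∑ j, u * S i * cuntzAij S u (i, j) x * (star (S j) * star u) = x := by
  calc ∑ i, ∑ j, u * S i * cuntzAij S u (i, j) x * (star (S j) * star u)
      = u * (∑ i, S i * star (S i)) * (star u * x * u) * (∑ j, S j * star (S j)) * star u := by
        simp only [cuntzAij, Finset.mul_sum, Finset.sum_mul, mul_assoc]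
        rw [Finset.sum_comm]
    _ = (u * star u) * x * (u * star u) := by
        rw [hS.sum_mul_star]; simp only [mul_one, mul_assoc]
    _ = x := by rw [Unitary.mul_star_self_of_mem hu, one_mul, mul_one]

variable [Algebra ℂ A]


theorem cuntzAij_mem_cuntzF [StarModule ℂ A] (hS : IsCuntzFamily S) {K : ℕ}
    (hu : u ∈ cuntzF S (K + 1)) (p : Fin n × Fin n) {x : A} (hx : x ∈ cuntzF S K) :
    cuntzAij S u p x ∈ cuntzF S K := by
  have hus := star_mem_cuntzF hu
  rw [cuntzF_eq_cuntzH] at *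
  have h := cuntzH_mul_cuntzH_le hS _ _ _ <| Submodule.mul_mem_mul
    (cuntzH_mul_cuntzH_le hS _ _ _ <| Submodule.mul_mem_mul hus (cuntzH_le_add hS _ _ 1 hx)) hu
  simpa only [cuntzAij, mul_assoc] using star_mul_mul_mem_cuntzH hS h p.1 p.2

theorem cuntzAij_map {L : A →⋆ₐ[ℂ] A} (hL : ∀ i, L (S i) = u * S i) (p : Fin n × Fin n) (y : A) :
    cuntzAij S u p (L y) = L (star (S p.1) * y * S p.2) := by
  simp [cuntzAij, map_star, hL, mul_assoc]

theorem foldr_cuntzAij_map_eq_smul_one (hS : IsCuntzFamily S) {L : A →⋆ₐ[ℂ] A}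
    (hL : ∀ i, L (S i) = u * S i) {y : A} (l : List (Fin n × Fin n))
    (hy : y ∈ cuntzF S l.length) : ∃ c : ℂ, l.foldr (cuntzAij S u) (L y) = c • (1 : A) := by
  rw [cuntzF_eq_cuntzH] at hy
  induction l using List.reverseRecOn generalizing y with
  | nil =>
    obtain ⟨c, rfl⟩ := Submodule.mem_one.1 (by simpa [cuntzH] using hy)
    exact ⟨c, by simp [Algebra.algebraMap_eq_smul_one]⟩
  | append_singleton l p ih =>
    rw [List.foldr_append, List.foldr_cons, List.foldr_nil, cuntzAij_map hL]
    rw [List.length_append, List.length_singleton] at hy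
    exact ih (star_mul_mul_mem_cuntzH hS hy p.1 p.2)

theorem exists_map_eq_of_foldr_cuntzAij (hS : IsCuntzFamily S) (hu : u ∈ unitary A)
    {L : A →⋆ₐ[ℂ] A} (hL : ∀ i, L (S i) = u * S i) (m : ℕ) (x : A)
    (h : ∀ l : List (Fin n × Fin n), l.length = m →
      ∃ c : ℂ, l.foldr (cuntzAij S u) x = c • (1 : A)) : ∃ y ∈ cuntzF S m, L y = x := by
  simp only [cuntzF_eq_cuntzH]
  induction m generalizing x with
  | zero =>
    obtain ⟨c, hc⟩ := h [] rfl
    refine ⟨c • 1, Submodule.smul_mem _ _ (one_le_cuntzH hS 0 (Submodule.one_le.1 le_rfl)), ?_⟩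
    rw [map_smul, map_one, ← hc, List.foldr_nil]
  | succ m ih =>
    choose y hy hLy using fun p : Fin n × Fin n => ih (cuntzAij S u p x) fun l hl => by
      simpa using h (l ++ [p]) (by simp [hl])
    refine ⟨∑ i, ∑ j, S i * y (i, j) * star (S j), sum_mem fun i _ => sum_mem fun j _ =>
      mul_mul_star_mem_cuntzH (hy (i, j)) i j, ?_⟩
    conv_rhs => rw [← sum_mul_cuntzAij_mul hS hu x]
    simp [map_star, hL, hLy]

theorem exists_map_eq_star [StarModule ℂ A] (hS : IsCuntzFamily S) (hu : u ∈ unitary A)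
    {L : A →⋆ₐ[ℂ] A} (hL : ∀ i, L (S i) = u * S i) {K m : ℕ} (huF : u ∈ cuntzF S (K + 1))
    (h : ∀ l : List (Fin n × Fin n), l.length = m →
      ∀ x ∈ cuntzF S K, ∃ c : ℂ, l.foldr (cuntzAij S u) x = c • (1 : A)) :
    ∃ w ∈ cuntzF S (m + 1), L w = star u := by
  refine exists_map_eq_of_foldr_cuntzAij hS hu hL (m + 1) _ fun l hl => ?_
  obtain rfl | ⟨l, p, rfl⟩ := l.eq_nil_or_concat
  · simp at hl
  rw [List.concat_eq_append, List.foldr_append, List.foldr_cons, List.foldr_nil]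
  refine h l (by simpa using hl) _ ?_
  have hus := star_mem_cuntzF huF
  have hp : cuntzAij S u p (star u) = star (S p.1) * star u * S p.2 := by
    rw [cuntzAij, mul_assoc _ (star u) u, Unitary.star_mul_self_of_mem hu, mul_one]
  rw [hp]
  rw [cuntzF_eq_cuntzH] at *
  exact star_mul_mul_mem_cuntzH hS hus _ _

theorem foldr_cuntzAij_mem_cuntzXi {K : ℕ} {x : A} (hx : x ∈ cuntzF S K)
    (l : List (Fin n × Fin n)) : l.foldr (cuntzAij S u) x ∈ cuntzXi S u K l.length := by
  induction l with
  | nil => exact hx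
  | cons p l ih => exact Submodule.subset_span ⟨p, _, ih, rfl⟩

theorem cuntzXi_eq_span_foldr (K m : ℕ) : cuntzXi S u K m = Submodule.span ℂ
    {y | ∃ l : List (Fin n × Fin n), l.length = m ∧ ∃ x ∈ cuntzF S K,
      y = l.foldr (cuntzAij S u) x} := by
  refine le_antisymm ?_ <| Submodule.span_le.2 ?_
  · induction m with
    | zero => exact fun x hx => Submodule.subset_span ⟨[], rfl, x, hx, rfl⟩
    | succ m ih =>
      refine Submodule.span_le.2 ?_
      rintro _ ⟨p, x, hx, rfl⟩
      rw [SetLike.mem_coe]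
      refine Submodule.span_induction (fun y hy => ?_) ?_ (fun y z _ _ hy hz => ?_)
        (fun a y _ hy => ?_) (ih hx)
      · obtain ⟨l, hl, x, hx, rfl⟩ := hy
        exact Submodule.subset_span ⟨p :: l, by simp [hl], x, hx, rfl⟩
      · simp [cuntzAij]
      · simpa [cuntzAij, mul_add, add_mul] using add_mem hy hz
      · simpa [cuntzAij] using Submodule.smul_mem _ a hy
  · rintro _ ⟨l, rfl, x, hx, rfl⟩
    exact foldr_cuntzAij_mem_cuntzXi hx l

theorem cuntzXi_antitone [StarModule ℂ A] (hS : IsCuntzFamily S) {K : ℕ}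
    (hu : u ∈ cuntzF S (K + 1)) : Antitone (cuntzXi S u K) := by
  refine antitone_nat_of_succ_le fun r => ?_
  induction r with
  | zero =>
    refine Submodule.span_le.2 ?_
    rintro _ ⟨p, x, hx, rfl⟩
    exact cuntzAij_mem_cuntzF hS hu p hx
  | succ r ih =>
    refine Submodule.span_mono ?_
    rintro _ ⟨p, x, hx, rfl⟩
    exact ⟨p, x, ih hx, rfl⟩

theorem one_mem_cuntzXi (hn : 1 ≤ n) (hS : IsCuntzFamily S) (hu : u ∈ unitary A) (K r : ℕ) :
    1 ∈ cuntzXi S u K r := by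
  induction r with
  | zero =>
    rw [cuntzXi, cuntzF_eq_cuntzH]
    exact one_le_cuntzH hS K (Submodule.one_le.1 le_rfl)
  | succ r ih =>
    exact Submodule.subset_span ⟨(⟨0, hn⟩, ⟨0, hn⟩), 1, ih, (cuntzAij_one hS hu _).symm⟩

theorem exists_iInf_cuntzXi_eq [StarModule ℂ A] (hS : IsCuntzFamily S) {K : ℕ}
    (hu : u ∈ cuntzF S (K + 1)) : ∃ m, ⨅ r, cuntzXi S u K r = cuntzXi S u K m := by
  have hanti := cuntzXi_antitone hS hu
  have hfin : FiniteDimensional ℂ (cuntzF S K) := by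
    rw [cuntzF_eq_cuntzH, cuntzH, cuntzV, cuntzVStar]
    exact .of_fg <| ((Submodule.fg_span (Set.finite_range _)).pow _).mul
      ((Submodule.fg_span (Set.finite_range _)).pow _)
  have hfin' : ∀ r, FiniteDimensional ℂ (cuntzXi S u K r) := fun r =>
    have : FiniteDimensional ℂ (cuntzXi S u K 0) := hfin
    Submodule.finiteDimensional_of_le (hanti (Nat.zero_le r))
  obtain ⟨m, -, hm⟩ := WellFounded.has_min
    (measure fun r => Module.finrank ℂ (cuntzXi S u K r)).wf Set.univ ⟨0, trivial⟩
  refine ⟨m, le_antisymm (iInf_le _ m) (le_iInf fun r => ?_)⟩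
  rcases le_total r m with h | h
  · exact hanti h
  · exact (Submodule.eq_of_le_of_finrank_le (hanti h) (not_lt.1 (hm r trivial))).ge

theorem nilpotent_iff_iInf_cuntzXi_eq [StarModule ℂ A] (hn : 1 ≤ n) (hS : IsCuntzFamily S)
    (hu : u ∈ unitary A) {K : ℕ} (huF : u ∈ cuntzF S (K + 1)) :
    (∃ m : ℕ, 1 ≤ m ∧ ∀ l : List (Fin n × Fin n), l.length = m →
        ∀ x ∈ cuntzF S K, ∃ c : ℂ, l.foldr (cuntzAij S u) x = c • (1 : A)) ↔
      (⨅ r : ℕ, cuntzXi S u K r) = Submodule.span ℂ {(1 : A)} := by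
  constructor
  · rintro ⟨m, -, hm⟩
    refine le_antisymm ((iInf_le _ m).trans ?_) (le_iInf fun r => ?_)
    · rw [cuntzXi_eq_span_foldr]
      refine Submodule.span_le.2 ?_
      rintro _ ⟨l, hl, x, hx, rfl⟩
      obtain ⟨c, hc⟩ := hm l hl x hx
      exact Submodule.mem_span_singleton.2 ⟨c, hc.symm⟩
    · rw [Submodule.span_singleton_le_iff_mem]
      exact one_mem_cuntzXi hn hS hu K r
  · intro h
    obtain ⟨m, hm⟩ := exists_iInf_cuntzXi_eq hS huF
    refine ⟨m + 1, by omega, fun l hl x hx => ?_⟩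
    have h1 := foldr_cuntzAij_mem_cuntzXi (u := u) hx l
    rw [hl] at h1
    have h2 := cuntzXi_antitone hS huF (Nat.le_succ m) h1
    rw [← hm, h] at h2
    obtain ⟨c, hc⟩ := Submodule.mem_span_singleton.1 h2
    exact ⟨c, hc.symm⟩

end CuntzNilpotent


/-- for a unitary `u ∈ F_n^k` the following are equivalent:
(1) `λ_u` is invertible with localized inverse;
(2) the ring `A_u` is nilpotent, i.e. some `m`-fold composites of the maps
    `a_{ij}` send all of `F_n^{k-1}` into `ℂ1`;
(3) `⋂_r Ξ_r = ℂ1`. -/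
theorem stmt13 {A : Type*} [NormedRing A] [StarRing A] [CStarRing A]
    [CompleteSpace A] [NormedAlgebra ℂ A] [StarModule ℂ A]
    {n : ℕ} (hn : 2 ≤ n) (S : Fin n → A)
    (hiso : ∀ i, star (S i) * S i = 1)
    (hcuntz : ∑ i, S i * star (S i) = 1)
    (hgen : (StarAlgebra.adjoin ℂ (Set.range S)).topologicalClosure = ⊤)
    (k : ℕ) (hk : 1 ≤ k)
    (u : A) (huF : u ∈ cuntzF S k) (hu : u ∈ unitary A)
    (lu : A →⋆ₐ[ℂ] A) (hlu : ∀ i, lu (S i) = u * S i) :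
    ((∃ h : ℕ, 1 ≤ h ∧ ∃ w : A, w ∈ cuntzF S h ∧ w ∈ unitary A ∧
        ∃ lw : A →⋆ₐ[ℂ] A, (∀ i, lw (S i) = w * S i) ∧
          (∀ a : A, lu (lw a) = a) ∧ (∀ a : A, lw (lu a) = a)) ↔
      (∃ m : ℕ, 1 ≤ m ∧ ∀ l : List (Fin n × Fin n), l.length = m →
        ∀ x ∈ cuntzF S (k - 1), ∃ c : ℂ, l.foldr (cuntzAij S u) x = c • (1 : A))) ∧
    ((∃ m : ℕ, 1 ≤ m ∧ ∀ l : List (Fin n × Fin n), l.length = m →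
        ∀ x ∈ cuntzF S (k - 1), ∃ c : ℂ, l.foldr (cuntzAij S u) x = c • (1 : A)) ↔
      (⨅ r : ℕ, cuntzXi S u (k - 1) r) = Submodule.span ℂ {(1 : A)}) := by
  obtain ⟨K, rfl⟩ := Nat.exists_eq_add_of_le' hk
  rw [Nat.add_sub_cancel]
  have hS := isCuntzFamily_of_isometries S hiso hcuntz
  refine ⟨⟨?_, ?_⟩, nilpotent_iff_iInf_cuntzXi_eq (by omega) hS hu huF⟩
  · rintro ⟨h, hh, w, hwF, -, lw, hlw, hleft, -⟩
    obtain ⟨H, rfl⟩ := Nat.exists_eq_add_of_le' hh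
    refine ⟨K + H + 1, by omega, fun l hl x hx => ?_⟩
    rw [← hleft x]
    refine foldr_cuntzAij_map_eq_smul_one hS hlu l ?_
    rw [cuntzF_eq_cuntzH] at hx ⊢
    rw [hl]
    exact cuntzH_le_add hS _ _ 1 (map_mem_cuntzH hS hlw hwF hx)
  · rintro ⟨m, -, hm⟩
    obtain ⟨w, hwF, hw⟩ := exists_map_eq_star hS hu hlu huF hm
    have hiso' := isometry_of_mem_cuntzF hn hS hgen hlu hu huF
    have hluw : ∀ i, lu (w * S i) = S i := fun i => by
      rw [map_mul, hw, hlu, ← mul_assoc, Unitary.star_mul_self_of_mem hu, one_mul]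
    have hrange : (StarAlgebra.adjoin ℂ (Set.range S)).topologicalClosure ≤ lu.range := by
      refine StarSubalgebra.topologicalClosure_minimal (StarAlgebra.adjoin_le ?_)
        hiso'.isClosedEmbedding.isClosed_range
      rintro _ ⟨i, rfl⟩
      exact ⟨_, hluw i⟩
    have hsurj : Function.Surjective lu := fun a => hrange (by simp [hgen])
    let e := StarAlgEquiv.ofBijective lu ⟨hiso'.injective, hsurj⟩
    have hwu : w ∈ unitary A := by
      rw [Unitary.mem_iff]
      constructor <;> apply hiso'.injective
      · simp [hw, map_star, Unitary.mul_star_self_of_mem hu]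
      · simp [hw, map_star, Unitary.star_mul_self_of_mem hu]
    refine ⟨m + 1, by omega, w, hwF, hwu, (e.symm : A →⋆ₐ[ℂ] A), fun i => ?_, e.apply_symm_apply,
      e.symm_apply_apply⟩
    exact e.symm_apply_eq.2 (hluw i).symm
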